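/- arXiv:2209.13633 — 2 statements merged into one kernel-verified Lean document; each statement's English description precedes it below -/
import Mathlib

section
/- Let (τ,ω) be a biword in standard form, with τ ∈ [m]^k and ω ∈ [n]^k, and let 1 ≤ i < n. If e_i(ω) ≠ NULL, then the biword (τ, e_i(ω)) is again in standard form. -/
/-! # Common definitions: words, crystal operators, perforated tableaux, RSK -/

/-- `phiL i s` is 1 if the letter `s` equals `i`, else 0. -/
def phiL (i s : ℕ) : ℤ := if s = i then 1 else 0

/-- `epsL i s` is 1 if the letter `s` equals `i+1`, else 0. -/
def epsL (i s : ℕ) : ℤ := if s = i + 1 then 1 else 0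

/-- `c_e^i(w, j)`. -/
def ce (w : ℕ → ℕ) (i j : ℕ) : ℤ :=
  (∑ s ∈ Finset.Icc 1 j, epsL i (w s)) - (∑ s ∈ Finset.Icc 1 (j - 1), phiL i (w s))

/-- `c_f^i(w, j)` for a word of length `k`. -/
def cf (k : ℕ) (w : ℕ → ℕ) (i j : ℕ) : ℤ :=
  (∑ s ∈ Finset.Icc j k, phiL i (w s)) - (∑ s ∈ Finset.Icc (j + 1) k, epsL i (w s))

/-- `E` is the value `ε_i(w)` (maximum of `c_e^i(w,j)` over `1 ≤ j ≤ k`). -/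
def IsEps (k : ℕ) (w : ℕ → ℕ) (i : ℕ) (E : ℤ) : Prop :=
  (∃ j ∈ Finset.Icc 1 k, ce w i j = E) ∧ ∀ j ∈ Finset.Icc 1 k, ce w i j ≤ E

/-- `F` is the value `φ_i(w)` (maximum of `c_f^i(w,j)` over `1 ≤ j ≤ k`). -/
def IsPhi (k : ℕ) (w : ℕ → ℕ) (i : ℕ) (F : ℤ) : Prop :=
  (∃ j ∈ Finset.Icc 1 k, cf k w i j = F) ∧ ∀ j ∈ Finset.Icc 1 k, cf k w i j ≤ F

/-- `Raises k i w w'` : `w' = e_i(w)` (in particular `e_i(w) ≠ NULL`). -/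
def Raises (k i : ℕ) (w w' : ℕ → ℕ) : Prop :=
  ∃ E : ℤ, ∃ j : ℕ, IsEps k w i E ∧ j ∈ Finset.Icc 1 k ∧ ce w i j = E ∧
    (∀ j' ∈ Finset.Icc 1 k, ce w i j' = E → j ≤ j') ∧
    w j = i + 1 ∧ w' = Function.update w j i

/-- `Lowers k i w w'` : `w' = f_i(w)` (in particular `f_i(w) ≠ NULL`). -/
def Lowers (k i : ℕ) (w w' : ℕ → ℕ) : Prop :=
  ∃ F : ℤ, ∃ j : ℕ, IsPhi k w i F ∧ j ∈ Finset.Icc 1 k ∧ cf k w i j = F ∧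
    (∀ j' ∈ Finset.Icc 1 k, cf k w i j' = F → j' ≤ j) ∧
    w j = i ∧ w' = Function.update w j (i + 1)

/-- `w` is a word of length `k` in the alphabet `[n] = {1,…,n}`. -/
def IsWord (n k : ℕ) (w : ℕ → ℕ) : Prop := ∀ s ∈ Finset.Icc 1 k, w s ∈ Finset.Icc 1 n

/-- The number of letters of `w` (of length `k`) equal to `a`: component `a` of `wt(w)`. -/
def wtc (k : ℕ) (w : ℕ → ℕ) (a : ℕ) : ℕ :=
  ((Finset.Icc 1 k).filter (fun s => w s = a)).card

/-- The biword `(τ, ω)` of length `k` is in standard form. -/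
def StdForm (k : ℕ) (τ ω : ℕ → ℕ) : Prop :=
  (∀ j, 1 ≤ j → j < k → τ j ≤ τ (j + 1)) ∧
  (∀ j, 1 ≤ j → j < k → τ j = τ (j + 1) → ω (j + 1) ≤ ω j)

/-- One application of some raising operator `e_i`, `1 ≤ i < n`. -/
def RaiseStep (n k : ℕ) (w w' : ℕ → ℕ) : Prop := ∃ i, 1 ≤ i ∧ i < n ∧ Raises k i w w'

/-- `η` is a highest weight of `w`: obtained from `w` by finitely many raising
operators, and no raising operator applies to `η`. -/
def HighestOf (n k : ℕ) (w η : ℕ → ℕ) : Prop :=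
  Relation.ReflTransGen (RaiseStep n k) w η ∧ ∀ i, 1 ≤ i → i < n → ¬∃ η', Raises k i η η'

/-! ## Perforated tableaux -/

/-- A rectangular array of optionally-filled boxes, indexed by (row, column), 1-based. -/
abbrev Arr : Type := ℕ → ℕ → Option ℕ

/-- Conditions (i) and (ii) for a perforated tableau with `n` rows, content in `[m]`,
`ℓ` columns (together with confinement of the filled boxes to the grid). -/
def PCond (n m ℓ : ℕ) (E : Arr) : Prop :=
  (∀ r c a, E r c = some a → 1 ≤ r ∧ r ≤ n ∧ 1 ≤ c ∧ c ≤ ℓ ∧ 1 ≤ a ∧ a ≤ m) ∧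
  (∀ i r r' c, E r c = some i → E r' c = some i → r = r') ∧
  (∀ i r c r' c', E r c = some i → E r' c' = some i → c < c' → r' ≤ r) ∧
  (∀ i j r c r' c', i < j → E r c = some i → E r' c' = some j → r ≤ r' ∧ c ≤ c')

/-- The number of boxes of `E` (with `ℓ` columns) filled with `a` lying in row `r`. -/
def cnt (ℓ : ℕ) (E : Arr) (a r : ℕ) : ℕ :=
  ((Finset.Icc 1 ℓ).filter (fun c => E r c = some a)).card

/-- `E` is a perforated tableau with `n` rows, content in `[m]` and `ℓ` columns:
conditions (i), (ii) hold and `ℓ` is minimal for the given (value, row) multiplicities. -/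
def IsPTab (n m ℓ : ℕ) (E : Arr) : Prop :=
  PCond n m ℓ E ∧
  ∀ ℓ' (E' : Arr), PCond n m ℓ' E' → (∀ a r, cnt ℓ' E' a r = cnt ℓ E a r) → ℓ ≤ ℓ'

/-- One swap of a blank box with a horizontally adjacent filled box in the same row,
both `E` and the result `E'` being valid ptableaux. -/
def SwapStep (n m ℓ : ℕ) (E E' : Arr) : Prop :=
  IsPTab n m ℓ E ∧ IsPTab n m ℓ E' ∧
  ∃ r c,
    ((E r c = none ∧ E r (c + 1) ≠ none ∧ E' r c = E r (c + 1) ∧ E' r (c + 1) = none) ∨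
     (E r (c + 1) = none ∧ E r c ≠ none ∧ E' r (c + 1) = E r c ∧ E' r c = none)) ∧
    ∀ r' c', ¬(r' = r ∧ (c' = c ∨ c' = c + 1)) → E' r' c' = E r' c'

/-- Row-equivalence of ptableaux: finitely many swap steps. -/
def RowEquiv (n m ℓ : ℕ) : Arr → Arr → Prop := Relation.ReflTransGen (SwapStep n m ℓ)

/-- Number of filled boxes in row `r` among columns `1..c` (inclusive). -/
def filledUpTo (E : Arr) (r c : ℕ) : ℕ :=
  ((Finset.Icc 1 c).filter (fun c' => E r c' ≠ none)).card

/-- `E` is left-justified: its filled boxes lie weakly to the left of the corresponding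
boxes of any row-equivalent ptableau. -/
def LeftJust (n m ℓ : ℕ) (E : Arr) : Prop :=
  IsPTab n m ℓ E ∧ ∀ E', RowEquiv n m ℓ E E' → ∀ r c, filledUpTo E' r c ≤ filledUpTo E r c

/-- `E` is right-justified. -/
def RightJust (n m ℓ : ℕ) (E : Arr) : Prop :=
  IsPTab n m ℓ E ∧ ∀ E', RowEquiv n m ℓ E E' → ∀ r c, filledUpTo E r c ≤ filledUpTo E' r c

/-- Number of blank boxes in row `r`, among columns `1..ℓ`. -/
def blanksInRow (ℓ : ℕ) (E : Arr) (r : ℕ) : ℕ :=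
  ((Finset.Icc 1 ℓ).filter (fun c => E r c = none)).card

/-- `G` (with `ℓ2` columns) is the left-justified form `^*T[i,i+1]` of the two-row
ptableau formed by rows `i`, `i+1` of `E` (a ptableau with `ℓ` columns). -/
def IsLJ2 (m ℓ : ℕ) (E : Arr) (i : ℕ) (G : Arr) (ℓ2 : ℕ) : Prop :=
  IsPTab 2 m ℓ2 G ∧ LeftJust 2 m ℓ2 G ∧
  ∀ a, cnt ℓ2 G a 1 = cnt ℓ E a i ∧ cnt ℓ2 G a 2 = cnt ℓ E a (i + 1)

/-- `H` (with `ℓ2` columns) is the right-justified form `T[i,i+1]^*`. -/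
def IsRJ2 (m ℓ : ℕ) (E : Arr) (i : ℕ) (H : Arr) (ℓ2 : ℕ) : Prop :=
  IsPTab 2 m ℓ2 H ∧ RightJust 2 m ℓ2 H ∧
  ∀ a, cnt ℓ2 H a 1 = cnt ℓ E a i ∧ cnt ℓ2 H a 2 = cnt ℓ E a (i + 1)

/-- `PRaises n m ℓ i E E'` : `E' = e_i(E)` for ptableaux.  In `^*E[i,i+1]` the
right-most filled bottom box with a blank above it is located (column `c2`), and the
corresponding box of row `i+1` of `E` (column `c0`, same index from the left among
filled boxes of the row) is moved up into the blank above it. -/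
def PRaises (n m ℓ i : ℕ) (E E' : Arr) : Prop :=
  IsPTab n m ℓ E ∧
  ∃ (G : Arr) (ℓ2 c2 c0 : ℕ), IsLJ2 m ℓ E i G ℓ2 ∧
    c2 ∈ Finset.Icc 1 ℓ2 ∧ G 2 c2 ≠ none ∧ G 1 c2 = none ∧
    (∀ c', c' ∈ Finset.Icc 1 ℓ2 → G 2 c' ≠ none → G 1 c' = none → c' ≤ c2) ∧
    c0 ∈ Finset.Icc 1 ℓ ∧ E (i + 1) c0 ≠ none ∧ E i c0 = none ∧
    filledUpTo E (i + 1) c0 = filledUpTo G 2 c2 ∧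
    E' = fun r c =>
      if r = i ∧ c = c0 then E (i + 1) c0
      else if r = i + 1 ∧ c = c0 then none
      else E r c

/-- `PLowers n m ℓ i E E'` : `E' = f_i(E)` for ptableaux. -/
def PLowers (n m ℓ i : ℕ) (E E' : Arr) : Prop :=
  IsPTab n m ℓ E ∧
  ∃ (H : Arr) (ℓ2 c2 c0 : ℕ), IsRJ2 m ℓ E i H ℓ2 ∧
    c2 ∈ Finset.Icc 1 ℓ2 ∧ H 1 c2 ≠ none ∧ H 2 c2 = none ∧
    (∀ c', c' ∈ Finset.Icc 1 ℓ2 → H 1 c' ≠ none → H 2 c' = none → c2 ≤ c') ∧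
    c0 ∈ Finset.Icc 1 ℓ ∧ E i c0 ≠ none ∧ E (i + 1) c0 = none ∧
    filledUpTo E i c0 = filledUpTo H 1 c2 ∧
    E' = fun r c =>
      if r = i + 1 ∧ c = c0 then E i c0
      else if r = i ∧ c = c0 then none
      else E r c

/-- A ptableau is highest weight when no raising operator applies. -/
def PHighest (n m ℓ : ℕ) (E : Arr) : Prop :=
  ∀ i, 1 ≤ i → i < n → ¬∃ E', PRaises n m ℓ i E E'

/-- One application of some ptableau raising operator `e_i`, `1 ≤ i < n`. -/
def PRaiseStep (n m ℓ : ℕ) (E E' : Arr) : Prop :=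
  ∃ i, 1 ≤ i ∧ i < n ∧ PRaises n m ℓ i E E'

/-- One application of some ptableau crystal operator `e_i` or `f_i`, `1 ≤ i < n`. -/
def PStep (n m ℓ : ℕ) (E E' : Arr) : Prop :=
  ∃ i, 1 ≤ i ∧ i < n ∧ (PRaises n m ℓ i E E' ∨ PLowers n m ℓ i E E')

/-- Number of columns `s ∈ {1,…,k}` of the biword `(τ, ω)` equal to `(a, r)`. -/
def countPairs (k : ℕ) (τ ω : ℕ → ℕ) (a r : ℕ) : ℕ :=
  ((Finset.Icc 1 k).filter (fun s => τ s = a ∧ ω s = r)).card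

/-- `E = Perf(τ, ω)` (up to row-equivalence): the ptableau with a box filled with
`τ_s` in row `ω_s` for each `s`. -/
def IsPerf (n m k ℓ : ℕ) (τ ω : ℕ → ℕ) (E : Arr) : Prop :=
  IsPTab n m ℓ E ∧ ∀ a r, cnt ℓ E a r = countPairs k τ ω a r

/-- A (left-justified) array is a semistandard Young tableau: partition shape,
rows weakly increasing, columns strictly increasing. -/
def IsSSYT (E : Arr) : Prop :=
  (∀ r c, 1 ≤ c → E r (c + 1) ≠ none → E r c ≠ none) ∧
  (∀ r c, 1 ≤ r → E (r + 1) c ≠ none → E r c ≠ none) ∧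
  (∀ r c c' a b, c ≤ c' → E r c = some a → E r c' = some b → a ≤ b) ∧
  (∀ r r' c a b, r < r' → E r c = some a → E r' c = some b → a < b)

/-- `D` (with `m` rows, content in `[n]`, `ℓd` columns) is the dual of the ptableau `E`
(with `n` rows, content in `[m]`, `ℓ` columns): for each box of `E` filled with `i` in
row `j`, `D` has a box filled with `j` in row `i` (with multiplicity). -/
def IsDualOf (n m ℓ ℓd : ℕ) (E D : Arr) : Prop :=
  IsPTab n m ℓ E ∧ IsPTab m n ℓd D ∧ ∀ v r, cnt ℓd D v r = cnt ℓ E r v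

/-- Rotation by 180° composed with the value flip `j ↦ m + 1 − j`. -/
def RotArr (n m ℓ : ℕ) (E : Arr) : Arr :=
  fun r c => (E (n + 1 - r) (ℓ + 1 - c)).map (fun j => m + 1 - j)

/-- The word condition for a ptableau with `n` rows. -/
def WordCond (n ℓ : ℕ) (E : Arr) : Prop :=
  ∀ i k, 1 ≤ i → i + 1 ≤ n →
    ∑ r ∈ Finset.Icc (i + 1) (i + k + 1), cnt ℓ E (i + 1) r ≤
      ∑ r ∈ Finset.Icc i (i + k), cnt ℓ E i r

/-- `s'` is the value of the nearest filled box strictly above row `k` in column `col`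
of `R` (`s' = 0` if there is no filled box above). -/
def NearestAbove (R : Arr) (k col s' : ℕ) : Prop :=
  (s' = 0 ∧ ∀ r, r < k → R r col = none) ∨
  (∃ r, r < k ∧ R r col = some s' ∧ ∀ r', r < r' → r' < k → R r' col = none)

/-! ## Classic RSK via Schensted column insertion (tableaux stored as lists of columns) -/

/-- Insert `x` into a single column (stored top-to-bottom): replace the topmost entry
`≥ x` by `x`, returning the bumped entry; if none, append `x` at the bottom. -/
def bumpCol (x : ℕ) : List ℕ → Option ℕ × List ℕ
  | [] => (none, [x])
  | z :: rest =>
    if x ≤ z then (some z, x :: rest)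
    else
      let p := bumpCol x rest
      (p.1, z :: p.2)

/-- Column-insert `x` into a tableau stored as a list of columns (left to right). -/
def insertTab : List (List ℕ) → ℕ → List (List ℕ)
  | [], x => [[x]]
  | col :: rest, x =>
    match bumpCol x col with
    | (none, col') => col' :: rest
    | (some z, col') => col' :: insertTab rest z

/-- Grow the recording tableau `q` by placing `t` in the box where `pNew` grew from `pOld`. -/
def growQ : List (List ℕ) → List (List ℕ) → List (List ℕ) → ℕ → List (List ℕ)
  | pc :: pr, nc :: nr, qc :: qr, t =>
    if pc.length < nc.length then (qc ++ [t]) :: qr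
    else qc :: growQ pr nr qr t
  | _, _, q, t => q ++ [[t]]

/-- One step of RSK: insert the biword column `tx = (τ_j, ω_j)`. -/
def rskStep (pq : List (List ℕ) × List (List ℕ)) (tx : ℕ × ℕ) :
    List (List ℕ) × List (List ℕ) :=
  let P' := insertTab pq.1 tx.2
  (P', growQ pq.1 P' pq.2 tx.1)

/-- Classic RSK of a biword given as a list of columns `(τ_j, ω_j)`:
returns the pair (insertion tableau `P`, recording tableau `Q`), each stored
as a list of columns. -/
def rsk (bw : List (ℕ × ℕ)) : List (List ℕ) × List (List ℕ) :=
  bw.foldl rskStep ([], [])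

/-- The list `[(τ 1, ω 1), …, (τ k, ω k)]` of columns of a biword. -/
def bwList (k : ℕ) (τ ω : ℕ → ℕ) : List (ℕ × ℕ) :=
  (List.range k).map (fun j => (τ (j + 1), ω (j + 1)))

/-- The entry in row `r`, column `c` (1-based) of a tableau stored as a list of columns. -/
def tabEntry (cols : List (List ℕ)) : Arr := fun r c =>
  if 1 ≤ r ∧ 1 ≤ c then (cols.getD (c - 1) [])[r - 1]? else none

/-- The recursion `c_e^i(w, j+1) = c_e^i(w, j) + ε_i(w_{j+1}) - φ_i(w_j)`. -/
theorem ce_succ (w : ℕ → ℕ) (i : ℕ) {j : ℕ} (hj : 1 ≤ j) :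
    ce w i (j + 1) = ce w i j + epsL i (w (j + 1)) - phiL i (w j) := by
  obtain ⟨j, rfl⟩ := Nat.exists_eq_add_of_le' hj
  simp only [ce, Nat.add_sub_cancel]
  rw [Finset.sum_Icc_succ_top (b := j + 1) (by omega),
    Finset.sum_Icc_succ_top (b := j) (f := fun s => phiL i (w s)) (by omega)]
  ring

/-- if `(τ, ω)` is a standard-form biword and `e_i(ω) ≠ NULL`, then
`(τ, e_i(ω))` is again in standard form. -/
theorem stmt2 (n m k i : ℕ) (hn : 2 ≤ n) (hm : 1 ≤ m) (hk : 1 ≤ k)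
    (hi1 : 1 ≤ i) (hi2 : i < n)
    (τ ω ω' : ℕ → ℕ) (hτ : IsWord m k τ) (hω : IsWord n k ω)
    (hstd : StdForm k τ ω) (h : Raises k i ω ω') :
    StdForm k τ ω' := by
  obtain ⟨E, j, ⟨-, hmax⟩, hj, hE, -, hwj, rfl⟩ := h
  obtain ⟨hτmono, hωanti⟩ := hstd
  refine ⟨hτmono, fun p hp1 hpk hτp => ?_⟩
  have hle := hωanti p hp1 hpk hτp
  by_cases hpj : p = j
  · subst hpj
    have hne : ω (p + 1) ≠ i + 1 := by
      intro heq
      have hnext := hmax (p + 1) (Finset.mem_Icc.mpr ⟨by omega, hpk⟩)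
      rw [ce_succ ω i hp1, hE, heq, hwj] at hnext
      simp [epsL, phiL] at hnext
    rw [Function.update_self, Function.update_of_ne (by omega)]
    omega
  · rw [Function.update_of_ne hpj]
    by_cases hpj' : p + 1 = j
    · subst hpj'
      rw [Function.update_self]
      omega
    · rwa [Function.update_of_ne hpj']
end

section
/- Let T and T' be ptableaux with n rows and content in [m]. If T and T' are plactically equivalent (i.e., Bw(T) and Bw(T') have the same insertion tableau under classic RSK), then Rot(T) and Rot(T') are plactically equivalent. -/
/-- The elementary Knuth relations between words of length three. -/
inductive KnuthTriple : List ℕ → List ℕ → Prop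
  | swapLeft {x y z : ℕ} : x < y → y ≤ z → KnuthTriple [x, z, y] [z, x, y]
  | swapRight {x y z : ℕ} : x ≤ y → y < z → KnuthTriple [y, z, x] [y, x, z]

/-- Inserting `x` into the strictly increasing column `c` ejects `o` and leaves `c'`. -/
structure IsBump (x : ℕ) (c : List ℕ) (o : Option ℕ) (c' : List ℕ) : Prop where
  pairwise : c'.Pairwise (· < ·)
  mem_iff : ∀ t, t ∈ c' ↔ t = x ∨ (t ∈ c ∧ o ≠ some t)
  none_lt : o = none → ∀ s ∈ c, s < x
  some_mem : ∀ z, o = some z → z ∈ c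
  some_le : ∀ z, o = some z → x ≤ z
  some_min : ∀ z, o = some z → ∀ s ∈ c, x ≤ s → z ≤ s

theorem isBump_bumpCol (x : ℕ) {c : List ℕ} (hc : c.Pairwise (· < ·)) :
    IsBump x c (bumpCol x c).1 (bumpCol x c).2 := by
  induction c with
  | nil => constructor <;> simp [bumpCol]
  | cons s c ih =>
    rw [List.pairwise_cons] at hc
    obtain ⟨h1, h2, h3, h4, h5, h6⟩ := ih hc.2
    have hs := hc.1
    by_cases h : x ≤ s
    · simp only [bumpCol, h, if_true]
      constructor <;> grind [List.pairwise_cons]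
    · simp only [bumpCol, h, if_false]
      constructor <;> grind [List.pairwise_cons]

/-- Insertion of a word into a column: the resulting column and the word of ejected letters. -/
def bumpWord : List ℕ → List ℕ → List ℕ × List ℕ
  | c, [] => (c, [])
  | c, x :: w =>
    ((bumpWord (bumpCol x c).2 w).1, (bumpCol x c).1.toList ++ (bumpWord (bumpCol x c).2 w).2)

theorem IsBump.eq_some {x z : ℕ} {c c' : List ℕ} {o : Option ℕ} (h : IsBump x c o c')
    (hz : z ∈ c) (hx : x ≤ z) (hmin : ∀ s ∈ c, x ≤ s → z ≤ s) : o = some z := by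
  obtain ⟨-, -, h1, h2, h3, h4⟩ := h
  rcases o with _ | w
  · grind
  · grind

theorem IsBump.eq_none {x : ℕ} {c c' : List ℕ} {o : Option ℕ} (h : IsBump x c o c')
    (hlt : ∀ s ∈ c, s < x) : o = none := by
  obtain ⟨-, -, h1, h2, h3, h4⟩ := h
  rcases o with _ | w
  · rfl
  · grind

theorem IsBump.knuthTriple_swapLeft {x y z : ℕ} {c c1 c2 c3 d1 d2 d3 : List ℕ}
    {o1 o2 o3 p1 p2 p3 : Option ℕ}
    (hxy : x < y) (hyz : y ≤ z)
    (h1 : IsBump x c o1 c1) (h2 : IsBump z c1 o2 c2) (h3 : IsBump y c2 o3 c3)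
    (k1 : IsBump z c p1 d1) (k2 : IsBump x d1 p2 d2) (k3 : IsBump y d2 p3 d3) :
    (∀ t, t ∈ c3 ↔ t ∈ d3) ∧
      (o1.toList ++ (o2.toList ++ o3.toList) = p1.toList ++ (p2.toList ++ p3.toList) ∨
        KnuthTriple (o1.toList ++ (o2.toList ++ o3.toList))
          (p1.toList ++ (p2.toList ++ p3.toList))) := by
  have m1 := h1.mem_iff
  have m2 := h2.mem_iff
  have m3 := h3.mem_iff
  have n1 := k1.mem_iff
  have n2 := k2.mem_iff
  have n3 := k3.mem_iff
  rcases o1 with _ | a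
  · have l := h1.none_lt rfl
    obtain rfl := k1.eq_none (by grind)
    obtain rfl := h2.eq_none (by grind)
    obtain rfl := k2.eq_some (z := z) (by grind) (by grind) (by grind)
    obtain rfl := h3.eq_some (z := z) (by grind) (by grind) (by grind)
    obtain rfl := k3.eq_none (by grind)
    exact ⟨by grind, by simp⟩
  have ha := h1.some_mem a rfl
  have hxa := h1.some_le a rfl
  have la := h1.some_min a rfl
  rcases p1 with _ | w
  · have l := k1.none_lt rfl
    obtain rfl := h2.eq_none (by grind)
    obtain rfl := k2.eq_some (z := a) (by grind) (by grind) (by grind)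
    have hm : ∀ t, t ∈ c2 ↔ t ∈ d2 := by grind
    rcases o3 with _ | b
    · obtain rfl := k3.eq_none (by have := h3.none_lt rfl; grind)
      exact ⟨by grind, by simp⟩
    · obtain rfl := k3.eq_some (z := b) ((hm b).1 (h3.some_mem b rfl)) (h3.some_le b rfl)
        (by have := h3.some_min b rfl; grind)
      exact ⟨by grind, by simp⟩
  have hw := k1.some_mem w rfl
  have hzw := k1.some_le w rfl
  have lw := k1.some_min w rfl
  by_cases e : a = w
  · subst e
    obtain rfl := k2.eq_some (z := z) (by grind) (by grind) (by grind)
    obtain rfl := h3.eq_some (z := z) (by grind) (by grind) (by grind)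
    rcases o2 with _ | v
    · obtain rfl := k3.eq_none (by have := h2.none_lt rfl; grind)
      exact ⟨by grind, by simp⟩
    · have hv := h2.some_mem v rfl
      have hzv := h2.some_le v rfl
      have lv := h2.some_min v rfl
      have hav : a < v := by grind
      have hmin : ∀ s ∈ d2, y ≤ s → v ≤ s := by
        intro s hs hys
        have hsc : s ∈ c ∧ a ≠ s := by grind
        have has := la s hsc.1 (by omega)
        exact lv s (by grind) (by omega)
      obtain rfl := k3.eq_some (z := v) (by grind) (by grind) hmin
      exact ⟨by grind, .inr (.swapRight hzw hav)⟩
  · have haz : a < z := by grind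
    obtain rfl := h2.eq_some (z := w) (by grind) (by grind) (by grind)
    obtain rfl := k2.eq_some (z := a) (by grind) (by grind) (by grind)
    have hm : ∀ t, t ∈ c2 ↔ t ∈ d2 := by grind
    have hz2 : z ∈ c2 := by grind
    rcases o3 with _ | b
    · have := h3.none_lt rfl z hz2
      omega
    · have hb := h3.some_mem b rfl
      have hyb := h3.some_le b rfl
      have lb := h3.some_min b rfl
      obtain rfl := k3.eq_some (z := b) ((hm b).1 hb) hyb (by grind)
      have hab : a < b := by grind
      have hbw : b ≤ w := (lb z hz2 hyz).trans hzw
      exact ⟨by grind, .inr (.swapLeft hab hbw)⟩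

theorem IsBump.knuthTriple_swapRight {x y z : ℕ} {c c0 c1 c2 d1 d2 : List ℕ}
    {o o1 o2 p1 p2 : Option ℕ}
    (hxy : x ≤ y) (hyz : y < z) (h : IsBump y c o c0)
    (h1 : IsBump z c0 o1 c1) (h2 : IsBump x c1 o2 c2)
    (k1 : IsBump x c0 p1 d1) (k2 : IsBump z d1 p2 d2) :
    (∀ t, t ∈ c2 ↔ t ∈ d2) ∧
      (o.toList ++ (o1.toList ++ o2.toList) = o.toList ++ (p1.toList ++ p2.toList) ∨
        KnuthTriple (o.toList ++ (o1.toList ++ o2.toList))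
          (o.toList ++ (p1.toList ++ p2.toList))) := by
  have m := h.mem_iff
  have m1 := h1.mem_iff
  have m2 := h2.mem_iff
  have n1 := k1.mem_iff
  have n2 := k2.mem_iff
  have hy : y ∈ c0 := by grind
  rcases p1 with _ | b
  · have := k1.none_lt rfl y hy
    omega
  have hb := k1.some_mem b rfl
  have hxb := k1.some_le b rfl
  have lb := k1.some_min b rfl
  have hby := lb y hy hxy
  rcases o1 with _ | w
  · have l := h1.none_lt rfl
    obtain rfl := h2.eq_some (z := b) (by grind) (by grind) (by grind)
    obtain rfl := k2.eq_none (by grind)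
    exact ⟨by grind, by simp⟩
  · have hw := h1.some_mem w rfl
    have hzw := h1.some_le w rfl
    have lw := h1.some_min w rfl
    obtain rfl := h2.eq_some (z := b) (by grind) (by grind) (by grind)
    obtain rfl := k2.eq_some (z := w) (by grind) (by grind) (by grind)
    refine ⟨by grind, ?_⟩
    have hwc : w ∈ c ∧ o ≠ some w := by grind
    rcases o with _ | a
    · have := h.none_lt rfl w hwc.1
      omega
    · have hya := h.some_le a rfl
      have haw := h.some_min a rfl w hwc.1 (by omega)
      exact .inr (.swapRight (hby.trans hya) (lt_of_le_of_ne haw (by grind)))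

theorem KnuthTriple.bumpWord {c u v : List ℕ} (hc : c.Pairwise (· < ·)) (h : KnuthTriple u v) :
    (bumpWord c u).1 = (bumpWord c v).1 ∧
      ((bumpWord c u).2 = (bumpWord c v).2 ∨
        KnuthTriple (bumpWord c u).2 (bumpWord c v).2) := by
  have ext {l l' : List ℕ} (hl : l.Pairwise (· < ·)) (hl' : l'.Pairwise (· < ·))
      (H : ∀ t, t ∈ l ↔ t ∈ l') : l = l' :=
    ((List.perm_ext_iff_of_nodup (hl.imp ne_of_lt) (hl'.imp ne_of_lt)).2 H).eq_of_pairwise'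
      (hl.imp le_of_lt) (hl'.imp le_of_lt)
  cases h with
  | @swapLeft x y z hxy hyz =>
    have h1 := isBump_bumpCol x hc
    have h2 := isBump_bumpCol z h1.pairwise
    have h3 := isBump_bumpCol y h2.pairwise
    have k1 := isBump_bumpCol z hc
    have k2 := isBump_bumpCol x k1.pairwise
    have k3 := isBump_bumpCol y k2.pairwise
    have := IsBump.knuthTriple_swapLeft hxy hyz h1 h2 h3 k1 k2 k3
    simp only [_root_.bumpWord, List.append_nil]
    exact ⟨ext h3.pairwise k3.pairwise this.1, this.2⟩
  | @swapRight x y z hxy hyz =>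
    have h := isBump_bumpCol y hc
    have h1 := isBump_bumpCol z h.pairwise
    have h2 := isBump_bumpCol x h1.pairwise
    have k1 := isBump_bumpCol x h.pairwise
    have k2 := isBump_bumpCol z k1.pairwise
    have := IsBump.knuthTriple_swapRight hxy hyz h h1 h2 k1 k2
    simp only [_root_.bumpWord, List.append_nil]
    exact ⟨ext h2.pairwise k2.pairwise this.1, this.2⟩

theorem foldl_insertTab_cons (c : List ℕ) (T : List (List ℕ)) (w : List ℕ) :
    w.foldl insertTab (c :: T) = (bumpWord c w).1 :: (bumpWord c w).2.foldl insertTab T := by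
  induction w generalizing c T with
  | nil => simp [bumpWord]
  | cons x w ih =>
    rcases h : bumpCol x c with ⟨_ | z, c'⟩ <;> simp [bumpWord, insertTab, h, ih]

theorem KnuthTriple.foldl_insertTab_eq {u v : List ℕ} (h : KnuthTriple u v)
    {T : List (List ℕ)} (hT : ∀ c ∈ T, c.Pairwise (· < ·)) :
    u.foldl insertTab T = v.foldl insertTab T := by
  induction T generalizing u v with
  | nil =>
    cases h with
    | swapLeft hxy hyz =>
      simp [insertTab, bumpCol, hyz, (hxy.trans_le hyz).le, (hxy.trans_le hyz).not_ge,
        hxy.not_ge]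
    | swapRight hxy hyz =>
      simp [insertTab, bumpCol, hxy, hyz.not_ge, (hxy.trans_lt hyz).not_ge]
  | cons c T ih =>
    rw [foldl_insertTab_cons, foldl_insertTab_cons]
    have hb := h.bumpWord (hT c (by simp))
    rw [hb.1]
    rcases hb.2 with e | e
    · rw [e]
    · rw [ih e fun c hc => hT c (by simp [hc])]

theorem pairwise_insertTab {T : List (List ℕ)} (hT : ∀ c ∈ T, c.Pairwise (· < ·)) (x : ℕ) :
    ∀ c ∈ insertTab T x, c.Pairwise (· < ·) := by
  induction T generalizing x with
  | nil => simp [insertTab]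
  | cons c T ih =>
    have hb := (isBump_bumpCol x (hT c (by simp))).pairwise
    have hT' : ∀ c ∈ T, c.Pairwise (· < ·) := fun c hc => hT c (by simp [hc])
    rcases h : bumpCol x c with ⟨_ | z, c'⟩ <;> rw [h] at hb <;>
      simp only [insertTab, h, List.mem_cons, forall_eq_or_imp]
    · exact ⟨hb, hT'⟩
    · exact ⟨hb, ih hT' z⟩

theorem pairwise_foldl_insertTab {T : List (List ℕ)} (hT : ∀ c ∈ T, c.Pairwise (· < ·))
    (w : List ℕ) : ∀ c ∈ w.foldl insertTab T, c.Pairwise (· < ·) := by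
  induction w generalizing T with
  | nil => exact hT
  | cons x w ih => exact ih (pairwise_insertTab hT x)

/-- Two words are related when they differ by one elementary Knuth transformation. -/
inductive KnuthStep : List ℕ → List ℕ → Prop
  | mk (p s : List ℕ) {u v : List ℕ} (h : KnuthTriple u v) : KnuthStep (p ++ u ++ s) (p ++ v ++ s)

/-- Knuth equivalence of words. -/
abbrev KnuthEquiv : List ℕ → List ℕ → Prop := Relation.EqvGen KnuthStep

theorem KnuthTriple.equiv {u v : List ℕ} (h : KnuthTriple u v) : KnuthEquiv u v := by
  simpa using Relation.EqvGen.rel _ _ (KnuthStep.mk [] [] h)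

theorem KnuthEquiv.append {w w' : List ℕ} (h : KnuthEquiv w w') (p s : List ℕ) :
    KnuthEquiv (p ++ w ++ s) (p ++ w' ++ s) := by
  induction h with
  | rel _ _ h =>
    obtain ⟨p', s', h⟩ := h
    simpa using Relation.EqvGen.rel _ _ (KnuthStep.mk (p ++ p') (s' ++ s) h)
  | refl => exact .refl _
  | symm _ _ _ ih => exact .symm _ _ ih
  | trans _ _ _ _ _ ih₁ ih₂ => exact .trans _ _ _ ih₁ ih₂

theorem KnuthEquiv.cons {w w' : List ℕ} (h : KnuthEquiv w w') (x : ℕ) :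
    KnuthEquiv (x :: w) (x :: w') := by
  simpa using h.append [x] []

theorem KnuthEquiv.foldl_insertTab_eq {w w' : List ℕ} (h : KnuthEquiv w w') :
    w.foldl insertTab [] = w'.foldl insertTab [] := by
  induction h with
  | rel _ _ h =>
    obtain ⟨p, s, h⟩ := h
    simp only [List.foldl_append]
    rw [h.foldl_insertTab_eq (pairwise_foldl_insertTab (by simp) p)]
  | refl => rfl
  | symm _ _ _ ih => exact ih.symm
  | trans _ _ _ _ _ ih₁ ih₂ => exact ih₁.trans ih₂

theorem knuthEquiv_concat_of_le {s x : ℕ} {c : List ℕ} (hc : (s :: c).Pairwise (· < ·))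
    (hx : x ≤ s) : KnuthEquiv (s :: (c ++ [x])) (s :: x :: c) := by
  induction c generalizing s with
  | nil => exact .refl _
  | cons t c ih =>
    rw [List.pairwise_cons] at hc
    have hst := hc.1 t (by simp)
    refine .trans _ _ _ ((ih hc.2 (hx.trans hst.le)).cons s) ?_
    simpa using (KnuthTriple.swapRight hx hst).equiv.append [] c

theorem knuthEquiv_bumpCol (x : ℕ) {c : List ℕ} (hc : c.Pairwise (· < ·)) :
    KnuthEquiv (c ++ [x]) ((bumpCol x c).1.toList ++ (bumpCol x c).2) := by
  induction c with
  | nil => exact .refl _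
  | cons s c ih =>
    by_cases h : x ≤ s
    · simpa [bumpCol, h] using knuthEquiv_concat_of_le hc h
    · rw [List.pairwise_cons] at hc
      have hb := isBump_bumpCol x hc.2
      specialize ih hc.2
      simp only [bumpCol, h, if_false]
      generalize bumpCol x c = p at hb ih
      obtain ⟨_ | z, c'⟩ := p
      · exact ih.cons s
      · refine .trans _ _ _ (ih.cons s) ?_
        have hx : x ∈ c' := (hb.mem_iff x).2 (.inl rfl)
        rcases c' with _ | ⟨t, c'⟩
        · simp at hx
        · have hst : s < t := by
            rcases (hb.mem_iff t).1 (by simp) with rfl | h'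
            · omega
            · exact hc.1 t h'.1
          have htx : t ≤ x := by
            rcases List.mem_cons.1 hx with rfl | h'
            · rfl
            · exact ((List.pairwise_cons.1 hb.pairwise).1 x h').le
          have htz : t ≤ z := htx.trans (hb.some_le z rfl)
          simpa using (KnuthTriple.swapLeft hst htz).equiv.append [] c'

/-- The word of a tableau obtained by reading its columns from the last to the first, each of
them from top to bottom. -/
def columnWord : List (List ℕ) → List ℕ
  | [] => []
  | c :: T => columnWord T ++ c

theorem knuthEquiv_columnWord_insertTab {T : List (List ℕ)}
    (hT : ∀ c ∈ T, c.Pairwise (· < ·)) (x : ℕ) :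
    KnuthEquiv (columnWord T ++ [x]) (columnWord (insertTab T x)) := by
  induction T generalizing x with
  | nil => exact .refl _
  | cons c T ih =>
    have hb := (knuthEquiv_bumpCol x (hT c (by simp))).append (columnWord T) []
    specialize ih fun c hc => hT c (by simp [hc])
    rcases h : bumpCol x c with ⟨_ | z, c'⟩ <;> rw [h] at hb <;>
      simp only [insertTab, h, columnWord]
    · simpa using hb
    · refine .trans _ _ _ (by simpa using hb) (by simpa using (ih z).append [] c')

theorem knuthEquiv_columnWord_foldl {T : List (List ℕ)}
    (hT : ∀ c ∈ T, c.Pairwise (· < ·)) (w : List ℕ) :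
    KnuthEquiv (columnWord T ++ w) (columnWord (w.foldl insertTab T)) := by
  induction w generalizing T with
  | nil => simpa using .refl _
  | cons x w ih =>
    refine .trans _ _ _ ?_ (ih (pairwise_insertTab hT x))
    simpa using (knuthEquiv_columnWord_insertTab hT x).append [] w

theorem foldl_insertTab_eq_iff_knuthEquiv {w w' : List ℕ} :
    w.foldl insertTab [] = w'.foldl insertTab [] ↔ KnuthEquiv w w' := by
  refine ⟨fun h => ?_, KnuthEquiv.foldl_insertTab_eq⟩
  have h₁ : KnuthEquiv w _ := knuthEquiv_columnWord_foldl (T := []) (by simp) w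
  have h₂ : KnuthEquiv w' _ := knuthEquiv_columnWord_foldl (T := []) (by simp) w'
  exact .trans _ _ _ h₁ (.symm _ _ (h ▸ h₂))

/-- The reversed word with every letter `x` replaced by `n + 1 - x`. -/
def reverseComplement (n : ℕ) (w : List ℕ) : List ℕ := (w.map (n + 1 - ·)).reverse

theorem KnuthTriple.mem_iff {u v : List ℕ} (h : KnuthTriple u v) (t : ℕ) : t ∈ u ↔ t ∈ v := by
  cases h <;> grind

theorem KnuthTriple.reverseComplement {u v : List ℕ} {n : ℕ} (h : KnuthTriple u v)
    (hn : ∀ t ∈ u, t ≤ n) :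
    KnuthTriple (reverseComplement n v) (reverseComplement n u) := by
  cases h with
  | swapLeft hxy hyz =>
    simp only [List.mem_cons, List.not_mem_nil, or_false, forall_eq_or_imp, forall_eq] at hn
    exact .swapRight (by dsimp only; omega) (by dsimp only; omega)
  | swapRight hxy hyz =>
    simp only [List.mem_cons, List.not_mem_nil, or_false, forall_eq_or_imp, forall_eq] at hn
    exact .swapLeft (by dsimp only; omega) (by dsimp only; omega)

theorem KnuthEquiv.mem_iff {w w' : List ℕ} (h : KnuthEquiv w w') (t : ℕ) : t ∈ w ↔ t ∈ w' := by
  induction h with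
  | rel _ _ h =>
    obtain ⟨p, s, h⟩ := h
    simp [h.mem_iff t]
  | refl => rfl
  | symm _ _ _ ih => exact ih.symm
  | trans _ _ _ _ _ ih₁ ih₂ => exact ih₁.trans ih₂

theorem KnuthEquiv.reverseComplement {w w' : List ℕ} {n : ℕ} (h : KnuthEquiv w w')
    (hn : ∀ t ∈ w, t ≤ n) :
    KnuthEquiv (reverseComplement n w) (reverseComplement n w') := by
  induction h with
  | rel _ _ h =>
    obtain ⟨p, s, h⟩ := h
    have h' := h.reverseComplement (n := n) fun t ht => hn t (by simp [ht])
    simpa [_root_.reverseComplement] using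
      KnuthEquiv.append (.symm _ _ h'.equiv) (_root_.reverseComplement n s)
        (_root_.reverseComplement n p)
  | refl => exact .refl _
  | symm _ _ h ih => exact .symm _ _ (ih fun t ht => hn t ((KnuthEquiv.mem_iff h t).1 ht))
  | trans _ _ _ h _ ih₁ ih₂ =>
    exact .trans _ _ _ (ih₁ hn) (ih₂ fun t ht => hn t ((KnuthEquiv.mem_iff h t).2 ht))

theorem rsk_fst (bw : List (ℕ × ℕ)) : (rsk bw).1 = (bw.map Prod.snd).foldl insertTab [] := by
  suffices ∀ pq, (bw.foldl rskStep pq).1 = (bw.map Prod.snd).foldl insertTab pq.1 from this _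
  induction bw with
  | nil => simp
  | cons b bw ih => simp [ih, rskStep]

theorem count_bwList (k : ℕ) (τ ω : ℕ → ℕ) (a r : ℕ) :
    (bwList k τ ω).count (a, r) = countPairs k τ ω a r := by
  unfold bwList countPairs
  induction k with
  | zero => simp
  | succ k ih =>
    rw [List.range_succ, List.map_append, List.count_append, ih,
      ← Finset.insert_Icc_right_eq_Icc_add_one (by omega), Finset.filter_insert]
    by_cases h : τ (k + 1) = a ∧ ω (k + 1) = r
    · rw [if_pos h, Finset.card_insert_of_notMem (by simp)]
      simp [h.1, h.2]
    · rw [if_neg h]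
      simpa [List.count_singleton] using h

theorem mem_bwList {k : ℕ} {τ ω : ℕ → ℕ} {p : ℕ × ℕ} :
    p ∈ bwList k τ ω ↔ ∃ s ∈ Finset.Icc 1 k, p = (τ s, ω s) := by
  simp only [bwList, List.mem_map, List.mem_range, Finset.mem_Icc]
  constructor
  · rintro ⟨j, hj, rfl⟩
    exact ⟨j + 1, by omega, rfl⟩
  · rintro ⟨s, hs, rfl⟩
    exact ⟨s - 1, by omega, by rw [Nat.sub_add_cancel hs.1]⟩

/-- The order on the columns of a biword that underlies standard form. -/
def StdLE (p q : ℕ × ℕ) : Prop := p.1 < q.1 ∨ p.1 = q.1 ∧ q.2 ≤ p.2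

theorem StdForm.pairwise_bwList {k : ℕ} {τ ω : ℕ → ℕ} (h : StdForm k τ ω) :
    (bwList k τ ω).Pairwise StdLE := by
  have key : ∀ i j, 1 ≤ i → i ≤ j → j ≤ k → StdLE (τ i, ω i) (τ j, ω j) := by
    intro i j hi hij
    induction j, hij using Nat.le_induction with
    | base => exact fun _ => .inr ⟨rfl, le_rfl⟩
    | succ j hij ih =>
      intro hj
      have h₁ := h.1 j (by omega) (by omega)
      have h₂ := h.2 j (by omega) (by omega)
      have := ih (by omega)
      simp only [StdLE] at this ⊢
      omega
  refine List.pairwise_map.2 (List.pairwise_lt_range.imp_of_mem fun {i j} _ hj hij => ?_)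
  have := List.mem_range.1 hj
  exact key _ _ (by omega) (by omega) (by omega)

theorem cnt_rotArr {n m ℓ : ℕ} {T : Arr} (hT : PCond n m ℓ T) {a r : ℕ}
    (ha : a ∈ Finset.Icc 1 m) :
    cnt ℓ (RotArr n m ℓ T) a r = cnt ℓ T (m + 1 - a) (n + 1 - r) := by
  have hiff (c : ℕ) : RotArr n m ℓ T r c = some a ↔
      T (n + 1 - r) (ℓ + 1 - c) = some (m + 1 - a) := by
    rw [Finset.mem_Icc] at ha
    simp only [RotArr, Option.map_eq_some_iff]
    constructor
    · rintro ⟨b, hb, rfl⟩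
      have := hT.1 _ _ _ hb
      rw [hb]
      congr 1
      omega
    · exact fun h => ⟨_, h, by omega⟩
  unfold cnt
  refine Finset.card_nbij' (ℓ + 1 - ·) (ℓ + 1 - ·) ?_ ?_ ?_ ?_
  · intro c hc
    simp only [Finset.coe_filter, Finset.mem_Icc, Set.mem_ofPred_eq, hiff] at hc ⊢
    exact ⟨by omega, hc.2⟩
  · intro c hc
    simp only [Finset.coe_filter, Finset.mem_Icc, Set.mem_ofPred_eq, hiff] at hc ⊢
    exact ⟨by omega, by rw [Nat.sub_sub_self (by omega)]; exact hc.2⟩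
  · intro c hc
    simp only [Finset.coe_filter, Finset.mem_Icc, Set.mem_ofPred_eq] at hc
    simp only; omega
  · intro c hc
    simp only [Finset.coe_filter, Finset.mem_Icc, Set.mem_ofPred_eq] at hc
    simp only; omega

theorem bwList_rotArr {n m ℓ k : ℕ} {T : Arr} (hT : PCond n m ℓ T) {σ ρ σr ρr : ℕ → ℕ}
    (hσ : IsWord m k σ) (hρ : IsWord n k ρ) (hstd : StdForm k σ ρ)
    (hc : ∀ a r, countPairs k σ ρ a r = cnt ℓ T a r)
    (hσr : IsWord m k σr) (hρr : IsWord n k ρr) (hstdr : StdForm k σr ρr)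
    (hcr : ∀ a r, countPairs k σr ρr a r = cnt ℓ (RotArr n m ℓ T) a r) :
    bwList k σr ρr = ((bwList k σ ρ).map fun p => (m + 1 - p.1, n + 1 - p.2)).reverse := by
  set f : ℕ × ℕ → ℕ × ℕ := fun p => (m + 1 - p.1, n + 1 - p.2) with hf
  have range {σ ρ : ℕ → ℕ} (hσ : IsWord m k σ) (hρ : IsWord n k ρ) {p : ℕ × ℕ}
      (hp : p ∈ bwList k σ ρ) : (1 ≤ p.1 ∧ p.1 ≤ m) ∧ 1 ≤ p.2 ∧ p.2 ≤ n := by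
    obtain ⟨s, hs, rfl⟩ := mem_bwList.1 hp
    exact ⟨Finset.mem_Icc.1 (hσ s hs), Finset.mem_Icc.1 (hρ s hs)⟩
  have hsorted : ((bwList k σ ρ).map f).reverse.Pairwise StdLE := by
    rw [List.pairwise_reverse, List.pairwise_map]
    refine hstd.pairwise_bwList.imp_of_mem fun {p q} hp hq h => ?_
    have hp := range hσ hρ hp
    have hq := range hσ hρ hq
    simp only [StdLE, hf] at h ⊢
    omega
  have hperm : (bwList k σr ρr).Perm ((bwList k σ ρ).map f).reverse := by
    rw [List.perm_iff_count]
    rintro ⟨a, r⟩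
    rw [List.count_reverse]
    by_cases h : (1 ≤ a ∧ a ≤ m) ∧ 1 ≤ r ∧ r ≤ n
    · have hcount : ((bwList k σ ρ).map f).count (a, r) =
          (bwList k σ ρ).count (m + 1 - a, n + 1 - r) := by
        rw [List.count, List.countP_map, List.count]
        refine List.countP_congr fun p hp => ?_
        have := range hσ hρ hp
        simp only [hf, Function.comp_apply, beq_iff_eq, Prod.ext_iff]
        omega
      rw [hcount, count_bwList, count_bwList, hcr, hc, cnt_rotArr hT (Finset.mem_Icc.2 h.1)]
    · rw [List.count_eq_zero_of_not_mem fun h' => h (range hσr hρr h'),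
        List.count_eq_zero_of_not_mem]
      intro h'
      obtain ⟨p, hp, he⟩ := List.mem_map.1 h'
      have := range hσ hρ hp
      simp only [hf, Prod.ext_iff] at he
      omega
  refine hperm.eq_of_pairwise (fun p q _ _ hpq hqp => ?_) hstdr.pairwise_bwList hsorted
  simp only [StdLE] at hpq hqp
  ext <;> omega

theorem map_snd_bwList_rotArr {n m ℓ k : ℕ} {T : Arr} (hT : PCond n m ℓ T) {σ ρ σr ρr : ℕ → ℕ}
    (hσ : IsWord m k σ) (hρ : IsWord n k ρ) (hstd : StdForm k σ ρ)
    (hc : ∀ a r, countPairs k σ ρ a r = cnt ℓ T a r)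
    (hσr : IsWord m k σr) (hρr : IsWord n k ρr) (hstdr : StdForm k σr ρr)
    (hcr : ∀ a r, countPairs k σr ρr a r = cnt ℓ (RotArr n m ℓ T) a r) :
    (bwList k σr ρr).map Prod.snd = reverseComplement n ((bwList k σ ρ).map Prod.snd) := by
  simp [bwList_rotArr hT hσ hρ hstd hc hσr hρr hstdr hcr, reverseComplement, Function.comp_def]

/-- if ptableaux `T` and `T'` are plactically equivalent (their biwords
have the same insertion tableau under classic RSK), then `Rot(T)` and `Rot(T')` are
plactically equivalent. -/
theorem stmt18 (n m ℓ ℓ' k k' : ℕ) (T T' : Arr)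
    (hT : IsPTab n m ℓ T) (hT' : IsPTab n m ℓ' T')
    (σ ρ σ' ρ' σr ρr σr' ρr' : ℕ → ℕ)
    (hσ : IsWord m k σ) (hρ : IsWord n k ρ) (hstd : StdForm k σ ρ)
    (hc : ∀ a r, countPairs k σ ρ a r = cnt ℓ T a r)
    (hσ' : IsWord m k' σ') (hρ' : IsWord n k' ρ') (hstd' : StdForm k' σ' ρ')
    (hc' : ∀ a r, countPairs k' σ' ρ' a r = cnt ℓ' T' a r)
    (hσr : IsWord m k σr) (hρr : IsWord n k ρr) (hstdr : StdForm k σr ρr)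
    (hcr : ∀ a r, countPairs k σr ρr a r = cnt ℓ (RotArr n m ℓ T) a r)
    (hσr' : IsWord m k' σr') (hρr' : IsWord n k' ρr') (hstdr' : StdForm k' σr' ρr')
    (hcr' : ∀ a r, countPairs k' σr' ρr' a r = cnt ℓ' (RotArr n m ℓ' T') a r)
    (hpl : (rsk (bwList k σ ρ)).1 = (rsk (bwList k' σ' ρ')).1) :
    (rsk (bwList k σr ρr)).1 = (rsk (bwList k' σr' ρr')).1 := by
  rw [rsk_fst, rsk_fst, foldl_insertTab_eq_iff_knuthEquiv] at hpl ⊢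
  rw [map_snd_bwList_rotArr hT.1 hσ hρ hstd hc hσr hρr hstdr hcr,
    map_snd_bwList_rotArr hT'.1 hσ' hρ' hstd' hc' hσr' hρr' hstdr' hcr']
  refine hpl.reverseComplement fun t ht => ?_
  obtain ⟨p, hp, rfl⟩ := List.mem_map.1 ht
  obtain ⟨s, hs, rfl⟩ := mem_bwList.1 hp
  exact (Finset.mem_Icc.1 (hρ s hs)).2
end
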